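/- Let F be a closed subset of ℝ and let f : F → ℝ be of class C^∞ in the sense that for every point x ∈ F there exist an open set U ⊆ ℝ containing x and a C^∞ function f̂ : U → ℝ with f̂ = f on U ∩ F. Then there exists a C^∞ function f̃ : ℝ → ℝ such that f̃ restricted to F equals f. -/

import Mathlib

/-- **Smooth Tietze extension theorem for ℝ.**
Let `F` be a closed subset of `ℝ` and let `f` be of class `C^∞` on `F`
in the sense that every point `x ∈ F` has an open neighbourhood `U` and a
function `f̂` that is `C^∞` on `U` and agrees with `f` on `U ∩ F`.
Then there is a `C^∞` function `f̃ : ℝ → ℝ` with `f̃ = f` on `F`. -/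
theorem smooth_tietze_extension (F : Set ℝ) (hF : IsClosed F) (f : ℝ → ℝ)
    (hf : ∀ x ∈ F, ∃ U : Set ℝ, IsOpen U ∧ x ∈ U ∧
      ∃ fhat : ℝ → ℝ, ContDiffOn ℝ (⊤ : ℕ∞) fhat U ∧ ∀ y ∈ U ∩ F, fhat y = f y) :
    ∃ ftilde : ℝ → ℝ, ContDiff ℝ (⊤ : ℕ∞) ftilde ∧ ∀ x ∈ F, ftilde x = f x := by
  have ht : ∀ x : ℝ, Convex ℝ {z : ℝ | x ∈ F → z = f x} := by
    intro x
    by_cases hx : x ∈ F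
    · simpa [hx] using convex_singleton (𝕜 := ℝ) (f x)
    · simpa [hx] using convex_univ (𝕜 := ℝ) (E := ℝ)
  obtain ⟨g, hg⟩ := exists_contMDiffMap_forall_mem_convex_of_local (n := (⊤ : ℕ∞))
    (modelWithCornersSelf ℝ ℝ) ht (by
      intro x
      by_cases hx : x ∈ F
      · obtain ⟨U, hU, hxU, fhat, hs, he⟩ := hf x hx
        exact ⟨U, hU.mem_nhds hxU, fhat, hs.contMDiffOn, fun y hy hyF => he y ⟨hy, hyF⟩⟩
      · exact ⟨Fᶜ, hF.isOpen_compl.mem_nhds hx, fun _ => 0, contMDiffOn_const,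
          fun y hy hyF => absurd hyF hy⟩)
  exact ⟨g, g.contMDiff.contDiff, fun x hx => hg x hx⟩
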